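/- Let q be a prime power and X = Spec F_q[x_1,…,x_n]/(f_1,…,f_ρ) a closed subscheme of affine n-space over F_q, with d = max_i deg f_i. Let B_q ⊆ (Z/qZ)^n be the image of a box [a_1−b_1,a_1+b_1] × … × [a_n−b_n,a_n+b_n] with |b_i| ≤ B, containing at most one representative of each congruence class modulo q. Then #(B_q ∩ X(F_q)) ≪_{n,ρ,d} B^{dim X}. -/

import Mathlib

open MvPolynomial

noncomputable section

/-- The zero locus in `K^n` of a set of polynomials. -/
def zeroLocusSet {K : Type*} [Field K] {n : ℕ} (S : Set (MvPolynomial (Fin n) K)) :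
    Set (Fin n → K) := {x | ∀ f ∈ S, eval x f = 0}

/-- The vanishing ideal of a set of points of `K^n`. -/
def vIdeal {K : Type*} [Field K] {n : ℕ} (S : Set (Fin n → K)) :
    Ideal (MvPolynomial (Fin n) K) where
  carrier := {f | ∀ x ∈ S, eval x f = 0}
  add_mem' := by intro a b ha hb x hx; simp [ha x hx, hb x hx]
  zero_mem' := by intro x hx; simp
  smul_mem' := by intro c f hf x hx; simp [smul_eq_mul, hf x hx]

/-- Dimension of (the Zariski closure of) a subset of `K^n`, as the Krull
dimension of its affine coordinate ring. -/
def coneDim {K : Type*} [Field K] {n : ℕ} (S : Set (Fin n → K)) : WithBot ℕ∞ :=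
  ringKrullDim (MvPolynomial (Fin n) K ⧸ vIdeal S)

/-- An `r×r` minor of the Jacobian matrix of a system of `r` polynomials,
given by a choice `c` of `r` columns. -/
def jacMinor {K : Type*} [Field K] {n r : ℕ} (f : Fin r → MvPolynomial (Fin n) K)
    (c : Fin r → Fin n) : MvPolynomial (Fin n) K :=
  (Matrix.of fun i j => pderiv (c j) (f i)).det

/-- The ideal of the singular locus (Jacobian criterion) of the system `f`. -/
def singIdeal {K : Type*} [Field K] {n r : ℕ} (f : Fin r → MvPolynomial (Fin n) K) :
    Ideal (MvPolynomial (Fin n) K) :=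
  Ideal.span (Set.range f ∪ Set.range (jacMinor f))

/-- The projective scheme cut out by the system `f` is non-singular: any prime
containing the singular ideal contains the irrelevant ideal. -/
def ProjNonsingular {K : Type*} [Field K] {n r : ℕ} (f : Fin r → MvPolynomial (Fin n) K) :
    Prop :=
  ∀ P : Ideal (MvPolynomial (Fin n) K), P.IsPrime → singIdeal f ≤ P →
    ∀ i, MvPolynomial.X i ∈ P

/-- The directional derivative polynomial `G^y = y · ∇G`. -/
def polY {K : Type*} [Field K] {n : ℕ} (y : Fin n → K) (G : MvPolynomial (Fin n) K) :
    MvPolynomial (Fin n) K :=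
  ∑ i, C (y i) * pderiv i G

end

/-- A finite set of points on which a family of nonzero polynomials vanishes has at most as many
elements as there are monomials not divisible by a leading monomial of the family. -/
theorem card_le_card_standard_monomials {σ K : Type*} [Field K] (m : MonomialOrder σ)
    (Z : Finset (σ → K)) (G : Set (MvPolynomial σ K)) (hG : ∀ g ∈ G, g ≠ 0)
    (hGZ : ∀ g ∈ G, ∀ z ∈ Z, eval z g = 0) (T : Finset (σ →₀ ℕ))
    (hT : ∀ β, (∀ g ∈ G, ¬ m.degree g ≤ β) → β ∈ T) : Z.card ≤ T.card := by
  classical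
  have hinj : Function.Injective
      (fun z : Z => ((eval (z : σ → K) : MvPolynomial σ K →+* K) : MvPolynomial σ K →* K)) := by
    intro z w h
    apply Subtype.ext
    funext i
    simpa using DFunLike.congr_fun h (X i)
  have hli := (linearIndependent_monoidHom (MvPolynomial σ K) K).comp _ hinj
  let φ : (Z → K) →ₗ[K] (T → K) :=
    { toFun := fun c β => ∑ z, c z * eval (z : σ → K) (monomial (β : σ →₀ ℕ) 1)
      map_add' := by
        intro c c'
        funext β
        simp [add_mul, Finset.sum_add_distrib]
      map_smul' := by
        intro r c
        funext β
        simp [mul_assoc, Finset.mul_sum] }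
  have hφ : Function.Injective φ := by
    rw [← LinearMap.ker_eq_bot, LinearMap.ker_eq_bot']
    intro c hc
    funext z
    refine Fintype.linearIndependent_iff.1 hli c ?_ z
    funext p
    obtain ⟨g, r, hp, -, hr⟩ := m.div_set (B := G)
      (fun b hb => isUnit_iff_ne_zero.2 (m.leadingCoeff_ne_zero_iff.2 (hG b hb))) p
    have heval : ∀ z : Z, eval (z : σ → K) p = eval (z : σ → K) r := by
      intro z
      rw [hp, map_add, Finsupp.linearCombination_apply, Finsupp.sum, map_sum,
        Finset.sum_eq_zero, zero_add]
      intro b _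
      simp [hGZ b b.2 z z.2]
    have hmon : ∀ β ∈ r.support,
        ∑ z, c z * eval (z : σ → K) (monomial β (coeff β r)) = 0 := by
      intro β hβ
      have := congrFun hc ⟨β, hT β (hr β hβ)⟩
      simp only [φ, LinearMap.coe_mk, AddHom.coe_mk, Pi.zero_apply] at this
      calc _ = coeff β r * ∑ z, c z * eval (z : σ → K) (monomial β 1) := by
            rw [Finset.mul_sum]
            refine Finset.sum_congr rfl fun z _ => ?_
            simp only [eval_monomial]
            ring
        _ = 0 := by rw [this, mul_zero]
    have hsum : ∑ z : Z, c z * eval (z : σ → K) r = 0 := by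
      conv_lhs => enter [2, z]; rw [r.as_sum, map_sum, Finset.mul_sum]
      rw [Finset.sum_comm]
      exact Finset.sum_eq_zero hmon
    simpa [Finset.sum_apply, heval] using hsum
  simpa using LinearMap.finrank_le_finrank_of_injective hφ

/-- Exponents smaller than `M` of which at most `e` entries are at least `D`. -/
noncomputable def sparseExponents (n e D M : ℕ) : Finset (Fin n →₀ ℕ) :=
  ((Finset.univ.filter fun U : Finset (Fin n) => U.card ≤ e).biUnion fun U =>
    Fintype.piFinset fun i => Finset.range (if i ∈ U then M else D)).map
      Finsupp.equivFunOnFinite.symm.toEmbedding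

theorem mem_sparseExponents {n e D M : ℕ} {β : Fin n →₀ ℕ} (hM : ∀ i, β i < M)
    (hD : (Finset.univ.filter fun i => D ≤ β i).card ≤ e) : β ∈ sparseExponents n e D M := by
  classical
  simp only [sparseExponents, Finset.mem_map_equiv, Equiv.symm_symm, Finset.mem_biUnion,
    Fintype.mem_piFinset]
  refine ⟨_, Finset.mem_filter.2 ⟨Finset.mem_univ _, hD⟩, fun i => ?_⟩
  by_cases h : D ≤ β i
  · simpa [h] using hM i
  · simpa [h] using not_le.1 h

theorem card_sparseExponents_le {n e D M : ℕ} {B : ℝ} (hD : 1 ≤ D) (hB : 1 ≤ B)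
    (hM : (M : ℝ) ≤ 3 * B) :
    ((sparseExponents n e D M).card : ℝ) ≤ 2 ^ n * (3 ^ n * D ^ n) * B ^ e := by
  classical
  have hD' : (1 : ℝ) ≤ D := by exact_mod_cast hD
  rw [sparseExponents, Finset.card_map]
  calc _ ≤ ((∑ U ∈ Finset.univ.filter fun U : Finset (Fin n) => U.card ≤ e,
        (Fintype.piFinset fun i => Finset.range (if i ∈ U then M else D)).card : ℕ) : ℝ) := by
        exact_mod_cast Finset.card_biUnion_le
    _ ≤ ∑ U ∈ Finset.univ.filter fun U : Finset (Fin n) => U.card ≤ e,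
          (3 ^ n * D ^ n) * B ^ e := by
        push_cast
        refine Finset.sum_le_sum fun U hU => ?_
        have hUe : U.card ≤ e := (Finset.mem_filter.1 hU).2
        rw [Fintype.card_piFinset]
        simp only [Finset.card_range]
        push_cast
        calc ∏ i : Fin n, (if i ∈ U then (M : ℝ) else D)
            ≤ ∏ i : Fin n, (3 * D) * (if i ∈ U then B else 1) := by
              refine Finset.prod_le_prod (fun _ _ => by positivity) fun i _ => ?_
              split_ifs
              · nlinarith
              · nlinarith
          _ = (3 ^ n * D ^ n) * B ^ U.card := by
              rw [Finset.prod_mul_distrib, Finset.prod_ite_mem]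
              simp [mul_pow]
          _ ≤ (3 ^ n * D ^ n) * B ^ e := by gcongr
    _ ≤ ∑ U : Finset (Fin n), (3 ^ n * D ^ n) * B ^ e := by
        refine Finset.sum_le_sum_of_subset_of_nonneg (Finset.filter_subset _ _)
          fun _ _ _ => by positivity
    _ = _ := by simp; ring

/-- If every coordinate projection of `Z` to `e + 1` coordinates lies on a hypersurface of degree
at most `D`, then `Z` has `O(B ^ e)` points in any box with sides of length `O(B)`. -/
theorem card_le_of_hypersurface_projections {K : Type*} [Field K] {n e D M : ℕ} {B : ℝ}
    (hD : 1 ≤ D) (hB : 1 ≤ B) (hM : (M : ℝ) ≤ 3 * B)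
    (Z : Finset (Fin n → K)) (S : Fin n → Finset K) (hS : ∀ i, (S i).card ≤ M)
    (hZS : ∀ z ∈ Z, ∀ i, z i ∈ S i)
    (h : ∀ s : Fin (e + 1) → Fin n, Function.Injective s →
      ∃ p : MvPolynomial (Fin (e + 1)) K, p ≠ 0 ∧ p.totalDegree ≤ D ∧
        ∀ z ∈ Z, eval (z ∘ s) p = 0) :
    (Z.card : ℝ) ≤ 2 ^ n * (3 ^ n * D ^ n) * B ^ e := by
  classical
  refine le_trans ?_ (card_sparseExponents_le hD hB hM)
  choose! p hp0 hpD hpZ using h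
  let m : MonomialOrder (Fin n) := MonomialOrder.lex
  let P : Fin n → MvPolynomial (Fin n) K := fun i => ∏ r ∈ S i, (X i - C r)
  have hPm : ∀ i, m.Monic (P i) := fun i => MonomialOrder.Monic.prod fun r _ => m.monic_X_sub_C i r
  have hPdeg : ∀ i, m.degree (P i) = Finsupp.single i (S i).card := by
    intro i
    rw [m.degree_prod_of_regular]
    · simp [m.degree_X_sub_C]
    · intro r _
      rw [(m.monic_X_sub_C i r).leadingCoeff_eq_one]
      exact isRegular_one
  refine Nat.cast_le.2 (card_le_card_standard_monomials m Z
    (Set.range P ∪ {g | ∃ s : Fin (e + 1) → Fin n, Function.Injective s ∧ g = rename s (p s)})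
    ?_ ?_ _ ?_)
  · rintro g (⟨i, rfl⟩ | ⟨s, hs, rfl⟩)
    · exact (hPm i).ne_zero
    · exact fun h0 => hp0 s hs (rename_injective s hs (by rw [h0, map_zero]))
  · rintro g (⟨i, rfl⟩ | ⟨s, hs, rfl⟩) z hz
    · simp only [P, map_prod]
      exact Finset.prod_eq_zero (hZS z hz i) (by simp)
    · rw [eval_rename]
      exact hpZ s hs z hz
  · intro β hβ
    refine mem_sparseExponents (fun i => ?_) ?_
    · have := hβ _ (Or.inl ⟨i, rfl⟩)
      rw [hPdeg, Finsupp.single_le_iff] at this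
      exact (not_le.1 this).trans_le (hS i)
    · by_contra hcard
      obtain ⟨U, hU, hUc⟩ := Finset.exists_subset_card_eq (Nat.succ_le_of_lt (not_le.1 hcard))
      let s : Fin (e + 1) → Fin n := U.orderEmbOfFin hUc
      have hs : Function.Injective s := (U.orderEmbOfFin hUc).injective
      refine hβ _ (Or.inr ⟨s, hs, rfl⟩) ?_
      have hne : rename s (p s) ≠ 0 :=
        fun h0 => hp0 s hs (rename_injective s hs (by rw [h0, map_zero]))
      obtain ⟨α, hα, hαp⟩ := coeff_rename_ne_zero s (p s) _
        (mem_support_iff.1 (m.degree_mem_support hne))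
      have hαD : ∀ j, α j ≤ D := fun j =>
        (Finsupp.le_degree j α).trans ((le_totalDegree (mem_support_iff.2 hαp)).trans (hpD s hs))
      rw [← hα]
      intro i
      by_cases hi : i ∈ Set.range s
      · obtain ⟨j, rfl⟩ := hi
        rw [Finsupp.mapDomain_apply hs]
        exact (hαD j).trans (Finset.mem_filter.1 (hU (U.orderEmbOfFin_mem hUc j))).2
      · rw [Finsupp.mapDomain_of_notMem_range _ _ hi]
        exact Nat.zero_le _

/-- A product of fields has Krull dimension zero. -/
theorem krullDimLE_zero_pi_field {ι : Type*} (L : ι → Type*) [∀ i, Field (L i)] :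
    Ring.KrullDimLE 0 (∀ i, L i) := by
  refine Ring.KrullDimLE.mk₀ fun I hI => ?_
  refine Ideal.Quotient.maximal_of_isField _ ?_
  have : I.IsPrime := hI
  refine ⟨⟨0, 1, zero_ne_one⟩, mul_comm, ?_⟩
  intro a ha
  obtain ⟨a, rfl⟩ := Ideal.Quotient.mk_surjective a
  refine ⟨Ideal.Quotient.mk I a⁻¹, ?_⟩
  rw [← map_mul, ← map_one (Ideal.Quotient.mk I), Ideal.Quotient.eq]
  have ha' : a ∉ I := fun h => ha (Ideal.Quotient.eq_zero_iff_mem.2 h)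
  refine (hI.mem_or_mem (?_ : a * (a * a⁻¹ - 1) ∈ I)).resolve_left ha'
  convert I.zero_mem
  funext i
  by_cases h : a i = 0 <;> simp [h]

/-- A monic polynomial over a product of algebraically closed fields is a product of monic linear
factors. -/
theorem exists_eq_prod_X_sub_C_of_monic_pi {ι : Type*} (L : ι → Type*) [∀ i, Field (L i)]
    [∀ i, IsAlgClosed (L i)] (p : Polynomial (∀ i, L i)) (hp : p.Monic) :
    ∃ r : Fin p.natDegree → ∀ i, L i, p = ∏ j, (Polynomial.X - Polynomial.C (r j)) := by
  have key : ∀ i, ∃ r : Fin p.natDegree → L i,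
      p.map (Pi.evalRingHom L i) = ∏ j, (Polynomial.X - Polynomial.C (r j)) := by
    intro i
    have hs := IsAlgClosed.splits (p.map (Pi.evalRingHom L i))
    have hm : (p.map (Pi.evalRingHom L i)).Monic := hp.map _
    obtain ⟨r, hr⟩ : ∃ r : Fin p.natDegree → L i,
        (List.ofFn r : Multiset (L i)) = (p.map (Pi.evalRingHom L i)).roots := by
      have hc : p.natDegree = (p.map (Pi.evalRingHom L i)).roots.toList.length := by
        rw [Multiset.length_toList, ← hs.natDegree_eq_card_roots, hp.natDegree_map]
      rw [hc]
      exact ⟨_, by rw [List.ofFn_get, Multiset.coe_toList]⟩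
    refine ⟨r, ?_⟩
    rw [hs.eq_prod_roots_of_monic hm, ← hr, Multiset.map_coe, Multiset.prod_coe, List.map_ofFn,
      List.prod_ofFn]
    rfl
  choose r hr using key
  refine ⟨fun j i => r i j, ?_⟩
  ext k i
  have := congrArg (fun q => Polynomial.coeff q k) (hr i)
  simp only [Polynomial.coeff_map, Pi.evalRingHom_apply] at this
  rw [this]
  have h2 : (∏ j, (Polynomial.X - Polynomial.C (r i j))) =
      (∏ j : Fin p.natDegree, (Polynomial.X - Polynomial.C (fun i => r i j))).map
        (Pi.evalRingHom L i) := by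
    simp [Polynomial.map_prod]
  rw [h2, Polynomial.coeff_map]
  rfl

/-- Nullstellensatz with parameters: polynomials over a product of algebraically closed fields
that generate the unit ideal in each component generate the unit ideal. -/
theorem one_mem_span_range_of_forall_component {ι σ κ : Type*} [Finite σ] [Fintype κ]
    (L : ι → Type*) [∀ i, Field (L i)] [∀ i, IsAlgClosed (L i)]
    (F : κ → MvPolynomial σ (∀ i, L i))
    (hF : ∀ i, (1 : MvPolynomial σ (L i)) ∈
      Ideal.span (Set.range fun k => map (Pi.evalRingHom L i) (F k))) :
    (1 : MvPolynomial σ (∀ i, L i)) ∈ Ideal.span (Set.range F) := by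
  classical
  by_contra h1
  obtain ⟨M, hM, hFM⟩ := Ideal.exists_le_maximal _ ((Ideal.ne_top_iff_one _).2 h1)
  have := krullDimLE_zero_pi_field L
  let fld : Field (MvPolynomial σ (∀ i, L i) ⧸ M) := Ideal.Quotient.field M
  have hintegral := comp_C_integral_of_surjective_of_isJacobsonRing
    (Ideal.Quotient.mk M) Ideal.Quotient.mk_surjective
  have hy : ∀ s : σ, ∃ y : ∀ i, L i, X s - C y ∈ M := by
    intro s
    obtain ⟨p, hp, hps⟩ := hintegral (Ideal.Quotient.mk M (X s))
    obtain ⟨r, hr⟩ := exists_eq_prod_X_sub_C_of_monic_pi L p hp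
    rw [hr, Polynomial.eval₂_finsetProd, Finset.prod_eq_zero_iff] at hps
    obtain ⟨j, -, hj⟩ := hps
    refine ⟨r j, Ideal.Quotient.eq_zero_iff_mem.1 ?_⟩
    simpa using hj
  choose y hy using hy
  have hCy : ∀ p : MvPolynomial σ (∀ i, L i), p - C (eval y p) ∈ M := by
    intro p
    rw [← Ideal.Quotient.eq]
    have : Ideal.Quotient.mk M = ((Ideal.Quotient.mk M).comp C).comp (eval y) := by
      refine ringHom_ext (fun r => by simp) fun s => ?_
      simpa using Ideal.Quotient.eq.2 (hy s)
    exact DFunLike.congr_fun this p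
  have hmem : ∀ k, C (eval y (F k)) ∈ M := by
    intro k
    have := M.sub_mem (hFM (Ideal.subset_span ⟨k, rfl⟩)) (hCy (F k))
    simpa using this
  have hne : ∀ i, ∃ k, eval y (F k) i ≠ 0 := by
    intro i
    by_contra! h0
    have hle : Ideal.span (Set.range fun k => map (Pi.evalRingHom L i) (F k)) ≤
        RingHom.ker (eval fun s => y s i) := by
      rw [Ideal.span_le]
      rintro _ ⟨k, rfl⟩
      rw [SetLike.mem_coe, RingHom.mem_ker, eval_map, ← h0 k]
      exact (eval₂_comp_left (Pi.evalRingHom L i) (RingHom.id _) y (F k)).symm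
    simpa using hle (hF i)
  choose k hk using hne
  apply hM.ne_top
  rw [Ideal.eq_top_iff_one]
  have : (1 : MvPolynomial σ (∀ i, L i)) =
      ∑ j, C (fun i => if k i = j then (eval y (F j) i)⁻¹ else 0) * C (eval y (F j)) := by
    simp only [← map_mul, ← map_sum]
    rw [← C_1]
    congr 1
    funext i
    rw [Finset.sum_apply, Finset.sum_eq_single (k i)]
    · simp [hk i]
    · intro j _ hj
      simp [hj.symm]
    · simp
  rw [this]
  exact M.sum_mem fun j _ => M.mul_mem_left _ (hmem j)

/-- Uniform degree bound for Bézout identities over algebraically closed fields. -/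
theorem exists_bezout_degree_bound_of_isAlgClosed (σ κ : Type) [Finite σ] [Fintype κ] (d : ℕ) :
    ∃ N : ℕ, ∀ (L : Type) [Field L] [IsAlgClosed L] (f : κ → MvPolynomial σ L),
      (∀ k, (f k).totalDegree ≤ d) → (1 : MvPolynomial σ L) ∈ Ideal.span (Set.range f) →
      ∃ g : κ → MvPolynomial σ L, (∀ k, (g k).totalDegree ≤ N) ∧ ∑ k, g k * f k = 1 := by
  classical
  by_contra! h
  choose L fld hcl f hfd hf1 hg using h
  have hfin : {s : σ →₀ ℕ | s.degree ≤ d}.Finite := Finsupp.finite_of_degree_le d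
  let F : κ → MvPolynomial σ (∀ i, L i) := fun k =>
    ∑ s ∈ hfin.toFinset, monomial s fun i => coeff s (f i k)
  have hFf : ∀ i k, map (Pi.evalRingHom L i) (F k) = f i k := by
    intro i k
    simp only [F, map_sum, map_monomial, Pi.evalRingHom_apply]
    conv_rhs => rw [(f i k).as_sum]
    refine (Finset.sum_subset (fun s hs => ?_) fun s _ hs => ?_).symm
    · exact hfin.mem_toFinset.2 ((le_totalDegree hs).trans (hfd i k))
    · simp [notMem_support_iff.1 hs]
  have h1 := one_mem_span_range_of_forall_component L F (by simpa only [hFf] using hf1)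
  obtain ⟨g, hg1⟩ := (Ideal.mem_span_range_iff_exists_fun).1 h1
  let N := Finset.univ.sup fun k => (g k).totalDegree
  refine hg N (fun k => map (Pi.evalRingHom L N) (g k)) (fun k => ?_) ?_
  · exact (Finset.sup_mono (support_map_subset _ _)).trans
      (Finset.le_sup (f := fun k => (g k).totalDegree) (Finset.mem_univ k))
  · have := congrArg (map (Pi.evalRingHom L N)) hg1
    simpa [hFf] using this

/-- Uniform degree bound for Bézout identities over arbitrary fields. -/
theorem exists_bezout_degree_bound (σ κ : Type) [Finite σ] [Fintype κ] (d : ℕ) :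
    ∃ N : ℕ, ∀ (L : Type) [Field L] (f : κ → MvPolynomial σ L),
      (∀ k, (f k).totalDegree ≤ d) → (1 : MvPolynomial σ L) ∈ Ideal.span (Set.range f) →
      ∃ g : κ → MvPolynomial σ L, (∀ k, (g k).totalDegree ≤ N) ∧ ∑ k, g k * f k = 1 := by
  classical
  obtain ⟨N, hN⟩ := exists_bezout_degree_bound_of_isAlgClosed σ κ d
  refine ⟨N, fun L _ f hfd hf1 => ?_⟩
  let E := AlgebraicClosure L
  obtain ⟨g, hgN, hg⟩ := hN E (fun k => map (algebraMap L E) (f k))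
    (fun k => (Finset.sup_mono (support_map_subset _ _)).trans (hfd k)) (by
      have := Ideal.mem_map_of_mem (map (algebraMap L E)) hf1
      rw [Ideal.map_span, ← Set.range_comp, map_one] at this
      exact this)
  obtain ⟨lam, hlam⟩ := LinearMap.exists_leftInverse_of_injective (Algebra.linearMap L E)
    (LinearMap.ker_eq_bot.2 (algebraMap L E).injective)
  have hlam1 : lam 1 = 1 := by simpa using DFunLike.congr_fun hlam (1 : L)
  let Λ : MvPolynomial σ E → MvPolynomial σ L := fun p =>
    ∑ s ∈ p.support, monomial s (lam (coeff s p))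
  have hΛ : ∀ p s, coeff s (Λ p) = lam (coeff s p) := by
    intro p s
    simp only [Λ, coeff_sum, coeff_monomial, Finset.sum_ite_eq', mem_support_iff]
    split_ifs with h
    · rfl
    · rw [not_not.1 h, map_zero]
  refine ⟨fun k => Λ (g k), fun k => ?_, ?_⟩
  · refine le_trans (Finset.sup_mono fun s hs => ?_) (hgN k)
    rw [mem_support_iff, hΛ] at hs
    exact mem_support_iff.2 fun h => hs (by rw [h, map_zero])
  · ext s
    have := congrArg (fun p => lam (coeff s p)) hg
    simp only [coeff_sum, coeff_mul, map_sum, coeff_map] at this ⊢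
    simp only [hΛ]
    have hsm : ∀ (a : E) (c : L), lam (a * algebraMap L E c) = lam a * c := by
      intro a c
      rw [mul_comm, ← Algebra.smul_def, map_smul, smul_eq_mul, mul_comm]
    simp only [hsm] at this
    rw [this, coeff_one, coeff_one]
    split_ifs <;> simp [hlam1]

/-- Cramer's rule for a linear system over a domain that is solvable over a larger field. -/
theorem exists_det_ne_zero_of_mulVec_eq {R L m n : Type*} [CommRing R] [Field L]
    [Algebra R L] [FaithfulSMul R L] [Fintype m] [Fintype n] (A : Matrix m n R) (b : m → R)
    (w : n → L) (hw : (A.map (algebraMap R L)).mulVec w = algebraMap R L ∘ b) :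
    ∃ (k : ℕ) (r : Fin k → m) (c : Fin k → n) (u : Fin k → R), Function.Injective r ∧
      (A.submatrix r c).det ≠ 0 ∧
      ∀ i, ∑ j, A i (c j) * u j = (A.submatrix r c).det * b i := by
  classical
  have hinj : Function.Injective (algebraMap R L) := FaithfulSMul.algebraMap_injective R L
  obtain ⟨κ, c, hc, hspan, hli⟩ := exists_linearIndependent' L (A.map (algebraMap R L)).col
  have : Finite κ := Finite.of_injective c hc
  have : Fintype κ := Fintype.ofFinite κ
  let A₁ : Matrix m κ L := (A.map (algebraMap R L)).submatrix id c
  have hA₁ : A₁.rank = Fintype.card κ := by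
    rw [← Matrix.rank_transpose]
    exact LinearIndependent.rank_matrix (M := A₁.transpose) hli
  obtain ⟨κ', r, hr, hspan', hli'⟩ := exists_linearIndependent' L A₁.row
  have : Finite κ' := Finite.of_injective r hr
  have : Fintype κ' := Fintype.ofFinite κ'
  have hcard : Fintype.card κ' = Fintype.card κ := by
    rw [← hA₁, Matrix.rank_eq_finrank_span_row, ← hspan', finrank_span_eq_card hli']
  let eκ : Fin (Fintype.card κ) ≃ κ := (Fintype.equivFin κ).symm
  let eκ' : Fin (Fintype.card κ) ≃ κ' := (Fintype.equivFinOfCardEq hcard).symm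
  let M : Matrix (Fin (Fintype.card κ)) (Fin (Fintype.card κ)) R :=
    A.submatrix (r ∘ eκ') (c ∘ eκ)
  have hdetL : IsUnit (M.map (algebraMap R L)).det := by
    rw [← Matrix.isUnit_iff_isUnit_det, ← Matrix.linearIndependent_rows_iff_isUnit]
    exact (hli'.comp eκ' eκ'.injective).map' (LinearEquiv.funCongrLeft L L eκ).toLinearMap
      (LinearEquiv.ker _)
  have hdet : M.det ≠ 0 := by
    intro h0
    rw [← RingHom.mapMatrix_apply, ← RingHom.map_det, h0, map_zero] at hdetL
    exact not_isUnit_zero hdetL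
  obtain ⟨w', hw'⟩ : ∃ w' : Fin (Fintype.card κ) → L,
      ∀ i, ∑ j, algebraMap R L (A i (c (eκ j))) * w' j = algebraMap R L (b i) := by
    have hb : algebraMap R L ∘ b ∈
        Submodule.span L (Set.range ((A.map (algebraMap R L)).col ∘ c)) := by
      rw [hspan, ← hw, ← Matrix.range_mulVecLin]
      exact ⟨w, rfl⟩
    obtain ⟨w', hw'⟩ := (Submodule.mem_span_range_iff_exists_fun L).1 hb
    refine ⟨w' ∘ eκ, fun i => ?_⟩
    have := congrFun hw' i
    rw [← Function.comp_apply (f := algebraMap R L) (g := b), ← this, Finset.sum_apply,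
      ← eκ.sum_comp]
    exact Finset.sum_congr rfl fun j _ => mul_comm _ _
  refine ⟨_, r ∘ eκ', c ∘ eκ, M.adjugate.mulVec (b ∘ r ∘ eκ'), hr.comp eκ'.injective, hdet,
    fun i => hinj ?_⟩
  have hu : algebraMap R L ∘ M.adjugate.mulVec (b ∘ r ∘ eκ') = algebraMap R L M.det • w' := by
    have h1 : algebraMap R L ∘ (b ∘ r ∘ eκ') = (M.map (algebraMap R L)).mulVec w' := by
      funext j
      exact (hw' (r (eκ' j))).symm
    have h2 : algebraMap R L ∘ M.adjugate.mulVec (b ∘ r ∘ eκ') =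
        (M.adjugate.map (algebraMap R L)).mulVec (algebraMap R L ∘ (b ∘ r ∘ eκ')) := by
      funext j
      exact RingHom.map_mulVec (algebraMap R L) _ _ j
    rw [h2, h1, Matrix.mulVec_mulVec, ← Matrix.map_mul, Matrix.adjugate_mul]
    funext j
    simp [Matrix.mulVec, dotProduct, Matrix.one_apply, apply_ite (algebraMap R L)]
  rw [map_sum, map_mul, ← hw' i, Finset.mul_sum]
  refine Finset.sum_congr rfl fun j _ => ?_
  have := congrFun hu j
  simp only [Function.comp_apply, Pi.smul_apply, smul_eq_mul] at this ⊢
  rw [map_mul, this]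
  ring

theorem totalDegree_det_le {σ K : Type*} [CommRing K] {k : ℕ}
    (A : Matrix (Fin k) (Fin k) (MvPolynomial σ K)) (hA : ∀ i j, (A i j).totalDegree ≤ 1) :
    A.det.totalDegree ≤ k := by
  rw [Matrix.det_apply]
  refine totalDegree_finsetSum_le fun τ _ => ?_
  refine (totalDegree_smul_le _ _).trans ((totalDegree_finsetProd _ _).trans ?_)
  exact (Finset.sum_le_sum fun i _ => hA _ _).trans (by simp)

/-- A Bézout identity of bounded degree over the field of rational functions yields, after clearing
denominators, a nonzero polynomial of bounded degree in the ideal. -/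
theorem exists_C_mem_span_of_bezout {σ τ κ K : Type*} [Field K] [Finite σ] [Fintype κ] {N d : ℕ}
    (f : κ → MvPolynomial σ (MvPolynomial τ K)) (hfd : ∀ k, (f k).totalDegree ≤ d)
    (hf1 : ∀ k s, (coeff s (f k)).totalDegree ≤ 1)
    (g : κ → MvPolynomial σ (FractionRing (MvPolynomial τ K)))
    (hgN : ∀ k, (g k).totalDegree ≤ N)
    (hg : ∑ k, g k * map (algebraMap _ (FractionRing (MvPolynomial τ K))) (f k) = 1) :
    ∃ h : MvPolynomial τ K, h ≠ 0 ∧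
      h.totalDegree ≤ {s : σ →₀ ℕ | s.degree ≤ N + d}.ncard ∧ C h ∈ Ideal.span (Set.range f) := by
  classical
  have hT := Finsupp.finite_of_degree_le (σ := σ) (N + d)
  have hS := Finsupp.finite_of_degree_le (σ := σ) N
  let T := hT.toFinset
  let S := hS.toFinset
  let A : Matrix T (κ × S) (MvPolynomial τ K) := Matrix.of fun t ks =>
    coeff (t : σ →₀ ℕ) (monomial (ks.2 : σ →₀ ℕ) 1 * f ks.1)
  obtain ⟨k, r, c, u, hr, hdet, hu⟩ := exists_det_ne_zero_of_mulVec_eq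
    (L := FractionRing (MvPolynomial τ K)) A (fun t => coeff (t : σ →₀ ℕ) 1)
    (fun ks => coeff (ks.2 : σ →₀ ℕ) (g ks.1)) (by
      funext t
      have hgS : ∀ k, g k = ∑ s : S, monomial (s : σ →₀ ℕ) (coeff (s : σ →₀ ℕ) (g k)) := by
        intro k
        conv_lhs => rw [(g k).as_sum]
        rw [Finset.sum_coe_sort S fun s => monomial s (coeff s (g k))]
        refine Finset.sum_subset (fun s hs => ?_) fun s _ hs => ?_
        · exact hS.mem_toFinset.2 ((le_totalDegree hs).trans (hgN k))
        · simp [notMem_support_iff.1 hs]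
      have h1 := congrArg (coeff (t : σ →₀ ℕ)) hg
      simp only [Function.comp_apply]
      have h2 : algebraMap _ (FractionRing (MvPolynomial τ K))
          (coeff (t : σ →₀ ℕ) (1 : MvPolynomial σ (MvPolynomial τ K))) =
          coeff (t : σ →₀ ℕ) 1 := by
        rw [← coeff_map, map_one]
      rw [h2, ← h1, coeff_sum, Matrix.mulVec, dotProduct, Fintype.sum_prod_type]
      refine Finset.sum_congr rfl fun k _ => ?_
      conv_rhs => rw [hgS k, Finset.sum_mul, coeff_sum]
      refine Finset.sum_congr rfl fun s _ => ?_
      simp only [A, Matrix.of_apply, Matrix.map_apply, coeff_monomial_mul', coeff_map]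
      split_ifs <;> simp [mul_comm])
  refine ⟨_, hdet, ?_, ?_⟩
  · refine (totalDegree_det_le _ fun i j => ?_).trans ?_
    · simp only [A, Matrix.of_apply, Matrix.submatrix_apply, coeff_monomial_mul', one_mul]
      split_ifs
      · exact hf1 _ _
      · simp
    · rw [Set.ncard_eq_toFinset_card _ hT]
      simpa using Fintype.card_le_of_injective r hr
  · have : C (A.submatrix r c).det =
        ∑ j, (C (u j) * monomial ((c j).2 : σ →₀ ℕ) 1) * f (c j).1 := by
      ext1 t
      rw [← mul_one (C (A.submatrix r c).det), coeff_C_mul, coeff_sum]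
      simp only [mul_assoc, coeff_C_mul]
      by_cases ht : t ∈ T
      · rw [← hu ⟨t, ht⟩]
        exact Finset.sum_congr rfl fun j _ => mul_comm _ _
      · have ht' : N + d < t.degree := by
          by_contra h
          exact ht (hT.mem_toFinset.2 (not_lt.1 h))
        rw [coeff_one, if_neg, mul_zero, Finset.sum_eq_zero]
        · intro j _
          rw [coeff_eq_zero_of_totalDegree_lt, mul_zero]
          refine lt_of_le_of_lt ((totalDegree_mul _ _).trans (add_le_add ?_ (hfd _))) ht'
          exact (totalDegree_monomial_le _ _).trans (hS.mem_toFinset.1 (c j).2.2)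
        · rintro rfl
          simp at ht'
    rw [this]
    exact Ideal.sum_mem _ fun j _ => Ideal.mul_mem_left _ _ (Ideal.subset_span ⟨_, rfl⟩)

theorem ringKrullDim_le_of_isIntegral_of_injective {R S : Type*} [CommRing R] [CommRing S]
    [Algebra R S] [Algebra.IsIntegral R S] [FaithfulSMul R S] :
    ringKrullDim R ≤ ringKrullDim S := by
  refine iSup_le fun l => ?_
  obtain ⟨P, hP, hlies⟩ := (inferInstance : Nonempty (Ideal.primesOver l.head.asIdeal S))
  obtain ⟨series, hseries, -⟩ := Ideal.exists_ltSeries_of_hasGoingUp (S := S) l P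
  rw [← hseries]
  exact Order.LTSeries.length_le_krullDim series

/-- A finitely generated algebra over a field that contains a polynomial ring in `k` variables has
Krull dimension at least `k`. -/
theorem natCast_le_ringKrullDim_of_injective {K A : Type} [Field K] [CommRing A] [Algebra K A]
    [Algebra.FiniteType K A] {k : ℕ} (ψ : MvPolynomial (Fin k) K →ₐ[K] A)
    (hψ : Function.Injective ψ) : (k : WithBot ℕ∞) ≤ ringKrullDim A := by
  obtain ⟨P, hP, hPψ⟩ := Ideal.exists_comap_eq_of_mem_minimalPrimes_of_injective
    (f := ψ.toRingHom) hψ ⊥ (by rw [IsDomain.minimalPrimes_eq_singleton_bot]; rfl)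
  let φ : MvPolynomial (Fin k) K →ₐ[K] A ⧸ P := (Ideal.Quotient.mkₐ K P).comp ψ
  have hφ : Function.Injective φ := by
    rw [injective_iff_map_eq_zero]
    intro p hp
    have : p ∈ P.comap ψ.toRingHom := Ideal.mem_comap.2 (Ideal.Quotient.eq_zero_iff_mem.1 hp)
    rwa [hPψ] at this
  obtain ⟨s, g, hg, hgint⟩ := exists_integral_inj_algHom_of_fg K (A ⧸ P)
  algebraize [g.toRingHom]
  have : FaithfulSMul (MvPolynomial (Fin s) K) (A ⧸ P) :=
    (faithfulSMul_iff_algebraMap_injective _ _).2 hg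
  have hks : k ≤ s := by
    have h1 := trdeg_add_eq K (MvPolynomial (Fin s) K) (A := A ⧸ P)
    rw [trdeg_eq_zero (R := MvPolynomial (Fin s) K), add_zero] at h1
    have h2 := trdeg_le_of_injective φ hφ
    rw [← h1] at h2
    simpa using h2
  calc (k : WithBot ℕ∞) ≤ s := by exact_mod_cast hks
    _ = ringKrullDim (MvPolynomial (Fin s) K) := by
      rw [MvPolynomial.ringKrullDim_of_isNoetherianRing]; simp
    _ ≤ ringKrullDim (A ⧸ P) := ringKrullDim_le_of_isIntegral_of_injective
    _ ≤ ringKrullDim A := ringKrullDim_quotient_le P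

/-- If the dimension of an affine scheme is less than `k`, any `k` coordinates satisfy a nontrivial
polynomial relation on it. -/
theorem exists_rename_mem_of_ringKrullDim_lt {K : Type} [Field K] {n k : ℕ}
    (I : Ideal (MvPolynomial (Fin n) K)) (hI : ringKrullDim (MvPolynomial (Fin n) K ⧸ I) < k)
    (s : Fin k → Fin n) : ∃ p : MvPolynomial (Fin k) K, p ≠ 0 ∧ rename s p ∈ I := by
  by_contra! h
  refine (natCast_le_ringKrullDim_of_injective ((Ideal.Quotient.mkₐ K I).comp (rename s))
    ?_).not_gt hI
  rw [injective_iff_map_eq_zero]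
  intro p hp
  by_contra hp0
  exact h p hp0 (Ideal.Quotient.eq_zero_iff_mem.1 hp)

theorem totalDegree_map_le {σ R S : Type*} [CommSemiring R] [CommSemiring S] (φ : R →+* S)
    (p : MvPolynomial σ R) : (map φ p).totalDegree ≤ p.totalDegree :=
  Finset.sup_mono (support_map_subset φ p)

/-- The equations `f` together with `X (s j) = t j`, over the polynomial ring in the parameters
`t`. -/
noncomputable def fiberSystem {σ τ κ K : Type*} [Field K] (f : κ → MvPolynomial σ K) (s : τ → σ) :
    κ ⊕ τ → MvPolynomial σ (MvPolynomial τ K) :=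
  Sum.elim (fun i => map C (f i)) fun j => X (s j) - C (X j)

theorem totalDegree_fiberSystem_le {σ τ κ K : Type*} [Field K] (f : κ → MvPolynomial σ K)
    (s : τ → σ) {d : ℕ} (hf : ∀ i, (f i).totalDegree ≤ d) (k : κ ⊕ τ) :
    (fiberSystem f s k).totalDegree ≤ d + 1 := by
  rcases k with i | j
  · exact (totalDegree_map_le _ _).trans ((hf i).trans d.le_succ)
  · refine (totalDegree_sub _ _).trans ?_
    simp [totalDegree_X]

theorem totalDegree_coeff_fiberSystem_le {σ τ κ K : Type*} [Field K] (f : κ → MvPolynomial σ K)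
    (s : τ → σ) (k : κ ⊕ τ) (m : σ →₀ ℕ) :
    (coeff m (fiberSystem f s k)).totalDegree ≤ 1 := by
  classical
  rcases k with i | j
  · simp [fiberSystem, coeff_map]
  · simp only [fiberSystem, Sum.elim_inr, coeff_sub, coeff_X, coeff_C]
    refine (totalDegree_sub _ _).trans (max_le ?_ ?_) <;> split_ifs <;> simp [totalDegree_X]

/-- If `k` coordinates satisfy a nontrivial relation modulo the equations `f`, the generic fibre of
the projection to these coordinates is empty. -/
theorem C_mem_span_fiberSystem {σ τ κ K : Type*} [Field K] (f : κ → MvPolynomial σ K) (s : τ → σ)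
    {p : MvPolynomial τ K} (hp : rename s p ∈ Ideal.span (Set.range f)) :
    C p ∈ Ideal.span (Set.range (fiberSystem f s)) := by
  set J := Ideal.span (Set.range (fiberSystem f s))
  have h1 : map C (rename s p) ∈ J := by
    have := Ideal.mem_map_of_mem (map (σ := σ) (C : K →+* MvPolynomial τ K)) hp
    rw [Ideal.map_span] at this
    refine Ideal.span_mono ?_ this
    rintro _ ⟨_, ⟨i, rfl⟩, rfl⟩
    exact ⟨Sum.inl i, rfl⟩
  have h2 : (Ideal.Quotient.mk J).comp ((map C).comp (rename s : _ →ₐ[K] _).toRingHom) =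
      (Ideal.Quotient.mk J).comp (C : MvPolynomial τ K →+* _) := by
    refine MvPolynomial.ringHom_ext (fun r => by simp) fun j => ?_
    simp only [RingHom.comp_apply, AlgHom.toRingHom_eq_coe, RingHom.coe_coe, rename_X, map_X]
    exact Ideal.Quotient.eq.2 (Ideal.subset_span ⟨Sum.inr j, rfl⟩)
  have h3 := DFunLike.congr_fun h2 p
  simp only [RingHom.comp_apply, AlgHom.toRingHom_eq_coe, RingHom.coe_coe] at h3
  rw [Ideal.Quotient.eq_zero_iff_mem.2 h1] at h3
  exact Ideal.Quotient.eq_zero_iff_mem.1 h3.symm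

/-- On an affine scheme of dimension less than `k` cut out by `ρ` equations of degree at most `d`,
any `k` coordinates of the rational points satisfy a nontrivial relation of bounded degree. -/
theorem exists_relation_degree_bound (n ρ d k : ℕ) : ∃ D : ℕ, ∀ (K : Type) [Field K]
    (f : Fin ρ → MvPolynomial (Fin n) K), (∀ i, (f i).totalDegree ≤ d) →
    ringKrullDim (MvPolynomial (Fin n) K ⧸ Ideal.span (Set.range f)) < k →
    ∀ s : Fin k → Fin n, ∃ p : MvPolynomial (Fin k) K, p ≠ 0 ∧ p.totalDegree ≤ D ∧
      ∀ z : Fin n → K, (∀ i, eval z (f i) = 0) → eval (z ∘ s) p = 0 := by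
  obtain ⟨N, hN⟩ := exists_bezout_degree_bound (Fin n) (Fin ρ ⊕ Fin k) (d + 1)
  refine ⟨{s : Fin n →₀ ℕ | s.degree ≤ N + (d + 1)}.ncard, fun K _ f hf hdim s => ?_⟩
  obtain ⟨p, hp0, hp⟩ := exists_rename_mem_of_ringKrullDim_lt _ hdim s
  let ι := algebraMap (MvPolynomial (Fin k) K) (FractionRing (MvPolynomial (Fin k) K))
  have hunit : 1 ∈ Ideal.span (Set.range fun i => map ι (fiberSystem f s i)) := by
    have h1 := Ideal.mem_map_of_mem (map (σ := Fin n) ι) (C_mem_span_fiberSystem f s hp)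
    rw [Ideal.map_span, ← Set.range_comp, map_C] at h1
    have h2 : ι p ≠ 0 := by
      simpa [ι] using hp0
    have h3 := Ideal.mul_mem_left _ (C (ι p)⁻¹) h1
    rwa [← C_mul, inv_mul_cancel₀ h2, C_1] at h3
  obtain ⟨g, hgN, hg⟩ := hN _ _ (fun i => (totalDegree_map_le _ _).trans
    (totalDegree_fiberSystem_le f s hf i)) hunit
  obtain ⟨h, h0, hdeg, hmem⟩ := exists_C_mem_span_of_bezout (fiberSystem f s)
    (totalDegree_fiberSystem_le f s hf) (totalDegree_coeff_fiberSystem_le f s) g hgN hg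
  refine ⟨h, h0, hdeg, fun z hz => ?_⟩
  have hker : Ideal.span (Set.range (fiberSystem f s)) ≤
      RingHom.ker (eval₂Hom (eval (z ∘ s)) z) := by
    rw [Ideal.span_le]
    rintro _ ⟨i | j, rfl⟩
    · have : (eval (z ∘ s)).comp (C : K →+* MvPolynomial (Fin k) K) = RingHom.id K := by
        ext; simp
      simpa [fiberSystem, RingHom.mem_ker, this] using hz i
    · simp [fiberSystem, RingHom.mem_ker]
  simpa [RingHom.mem_ker] using hker hmem

/-- Let `X = Spec F_q[x]/(f_1,…,f_ρ)` be a closed subscheme of `A^n`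
over `F_q` (`q` prime) with `d = max deg f_i` and `dim X = e`. For any box with side
half-lengths `|b_i| ≤ B` containing at most one representative of each congruence class
mod `q` (i.e. `2 b_i + 1 ≤ q`), the number of integer points of the box whose reduction
mod `q` lies on `X` is `≪_{n,ρ,d} B^{dim X}`. -/
theorem statement6 (n ρ d : ℕ) :
    ∃ C : ℝ, 0 < C ∧ ∀ q : ℕ, q.Prime →
      ∀ f : Fin ρ → MvPolynomial (Fin n) (ZMod q),
      (∀ i, (f i).totalDegree ≤ d) →
      ∀ e : ℕ,
      ringKrullDim (MvPolynomial (Fin n) (ZMod q) ⧸ Ideal.span (Set.range f))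
        = (e : WithBot ℕ∞) →
      ∀ (B : ℝ) (a b : Fin n → ℤ), 1 ≤ B → (∀ i, |(b i : ℝ)| ≤ B) →
      (∀ i, 2 * b i + 1 ≤ (q : ℤ)) →
      ((Set.ncard {x : Fin n → ℤ |
          (∀ i, a i - b i ≤ x i ∧ x i ≤ a i + b i) ∧
          ∀ j, eval (fun i => ((x i : ℤ) : ZMod q)) (f j) = 0} : ℕ) : ℝ)
        ≤ C * B ^ e := by
  choose D hD using exists_relation_degree_bound n ρ d
  let Dmax := 1 + ∑ k ∈ Finset.range (n + 1), D k
  refine ⟨2 ^ n * (3 ^ n * (Dmax : ℝ) ^ n), by positivity, ?_⟩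
  intro q hq f hf e he B a b hB hb hbq
  have : Fact q.Prime := ⟨hq⟩
  classical
  set T := {x : Fin n → ℤ | (∀ i, a i - b i ≤ x i ∧ x i ≤ a i + b i) ∧
    ∀ j, eval (fun i => ((x i : ℤ) : ZMod q)) (f j) = 0}
  have hT : T.Finite := (Set.finite_Icc (a - b) (a + b)).subset fun x hx =>
    ⟨fun i => (hx.1 i).1, fun i => (hx.1 i).2⟩
  let red : (Fin n → ℤ) → Fin n → ZMod q := fun x i => x i
  have hinj : Set.InjOn red T := by
    intro x hx y hy hxy
    funext i
    have h1 := (ZMod.intCast_eq_intCast_iff_dvd_sub _ _ _).1 (congrFun hxy i)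
    have h2 := hx.1 i
    have h3 := hy.1 i
    have h4 := hbq i
    have h5 := Int.eq_zero_of_abs_lt_dvd h1 (by rw [abs_lt]; constructor <;> linarith)
    linarith
  have hcard : T.ncard = (hT.toFinset.image red).card := by
    rw [Set.ncard_eq_toFinset_card T hT, Finset.card_image_of_injOn (by simpa using hinj)]
  rw [hcard]
  refine card_le_of_hypersurface_projections (M := ⌊2 * B + 1⌋₊) (Nat.le_add_right 1 _) hB
    ((Nat.floor_le (by linarith)).trans (by linarith)) _
    (fun i => (Finset.Icc (a i - b i) (a i + b i)).image (Int.cast : ℤ → ZMod q)) ?_ ?_ ?_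
  · intro i
    refine Finset.card_image_le.trans (Nat.le_floor ?_)
    have h1 := abs_le.1 (hb i)
    rw [Int.card_Icc, show a i + b i + 1 - (a i - b i) = 2 * b i + 1 by ring]
    have h2 : (((2 * b i + 1).toNat : ℤ) : ℝ) = ((max (2 * b i + 1) 0 : ℤ) : ℝ) := by
      rw [Int.toNat_eq_max]
    rw [Int.cast_natCast] at h2
    rw [h2]
    push_cast
    exact max_le (by linarith) (by linarith)
  · intro z hz i
    obtain ⟨x, hx, rfl⟩ := Finset.mem_image.1 hz
    have := (hT.mem_toFinset.1 hx).1 i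
    exact Finset.mem_image_of_mem _ (Finset.mem_Icc.2 this)
  · intro s hs
    have hen : e + 1 ≤ n := by simpa using Fintype.card_le_of_injective s hs
    obtain ⟨p, hp0, hpD, hp⟩ := hD (e + 1) (ZMod q) f hf
      (by rw [he]; exact_mod_cast e.lt_succ_self) s
    refine ⟨p, hp0, hpD.trans ?_, fun z hz => hp z ?_⟩
    · exact (Finset.single_le_sum (f := D) (fun _ _ => Nat.zero_le _)
        (Finset.mem_range.2 (by omega))).trans (Nat.le_add_left _ 1)
    · obtain ⟨x, hx, rfl⟩ := Finset.mem_image.1 hz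
      exact (hT.mem_toFinset.1 hx).2
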